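/- Catalan's identity for odd index: let r be a positive even integer and n an odd natural number with n ≥ r. Then Q̃_{n−r}·Q̃_{n+r} − Q̃_n² = −[α**·β**·((ab)^r − β^{2r}) + β**·α**·((ab)^r − α^{2r})]/((ab)^{r−1}·(α − β)²) − ε·[(α*·β**·α + α**·β*·β)·((ab)^r − β^{2r}) + (β*·α**·β + β**·α*·α)·((ab)^r − α^{2r})]/((ab)^r·(α − β)²). -/

import Mathlib

open Quaternion TrivSqZeroExt

/-- The bi-periodic Fibonacci sequence: `F 0 = 0`, `F 1 = 1`, and
`F n = a * F (n-1) + F (n-2)` if `n` is even, `F n = b * F (n-1) + F (n-2)` if `n` is odd. -/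
noncomputable def biF (a b : ℝ) : ℕ → ℝ
  | 0 => 0
  | 1 => 1
  | n + 2 => (if Even (n + 2) then a else b) * biF a b (n + 1) + biF a b n

/-- The bi-periodic Fibonacci quaternion `Q n = F n + F (n+1) i + F (n+2) j + F (n+3) k`. -/
noncomputable def biQ (a b : ℝ) (n : ℕ) : ℍ[ℝ] :=
  ⟨biF a b n, biF a b (n + 1), biF a b (n + 2), biF a b (n + 3)⟩

/-- The bi-periodic dual Fibonacci quaternion `Q̃ n = Q n + ε * Q (n+1)`,
an element of the dual numbers over the quaternions. -/
noncomputable def biDQ (a b : ℝ) (n : ℕ) : DualNumber ℍ[ℝ] :=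
  inl (biQ a b n) + DualNumber.eps * inl (biQ a b (n + 1))

/-- Binet's formula for the bi-periodic Fibonacci sequence, at even and odd indices. -/
theorem biF_binet {a b α β : ℝ} (hab : a * b ≠ 0) (hne : α ≠ β)
    (hα : α ^ 2 = a * b * α + a * b) (hβ : β ^ 2 = a * b * β + a * b) (m : ℕ) :
    biF a b (2 * m) = a / (a * b) ^ m * (α ^ (2 * m) - β ^ (2 * m)) / (α - β) ∧
      biF a b (2 * m + 1) = 1 / (a * b) ^ m * (α ^ (2 * m + 1) - β ^ (2 * m + 1)) / (α - β) := by
  have hd : α - β ≠ 0 := sub_ne_zero.mpr hne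
  induction m with
  | zero => simp [biF, hd]
  | succ m ih =>
    obtain ⟨h₀, h₁⟩ := ih
    have heven : Even (2 * m + 2) := ⟨m + 1, by ring⟩
    have hodd : ¬ Even (2 * m + 1 + 2) := by
      rw [Nat.not_even_iff_odd]; exact ⟨m + 1, by ring⟩
    have h₂ : biF a b (2 * m + 2) =
        a / (a * b) ^ (m + 1) * (α ^ (2 * m + 2) - β ^ (2 * m + 2)) / (α - β) := by
      rw [biF, if_pos heven, h₀, h₁, pow_add α _ 2, pow_add β _ 2, hα, hβ, pow_succ (a * b)]
      have := left_ne_zero_of_mul hab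
      have := right_ne_zero_of_mul hab
      field_simp
      ring
    refine ⟨h₂, ?_⟩
    change biF a b (2 * m + 1 + 2) =
      1 / (a * b) ^ (m + 1) * (α ^ (2 * m + 1 + 2) - β ^ (2 * m + 1 + 2)) / (α - β)
    rw [biF, if_neg hodd, h₂, h₁, pow_add α (2 * m + 1) 2, pow_add β (2 * m + 1) 2,
      pow_add α (2 * m) 2, pow_add β (2 * m) 2, hα, hβ, pow_succ (a * b)]
    have := left_ne_zero_of_mul hab
    have := right_ne_zero_of_mul hab
    field_simp
    linear_combination β ^ (2 * m) * hβ - α ^ (2 * m) * hα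

/-- Binet's formula for the bi-periodic Fibonacci quaternions, even index. -/
theorem biQ_binet_even {a b α β : ℝ} (hab : a * b ≠ 0) (hne : α ≠ β)
    (hα : α ^ 2 = a * b * α + a * b) (hβ : β ^ 2 = a * b * β + a * b) (m : ℕ) :
    biQ a b (2 * m) = (1 / ((a * b) ^ m * (α - β))) •
      (α ^ (2 * m) • (⟨a, α, a / (a * b) * α ^ 2, 1 / (a * b) * α ^ 3⟩ : ℍ[ℝ]) -
        β ^ (2 * m) • (⟨a, β, a / (a * b) * β ^ 2, 1 / (a * b) * β ^ 3⟩ : ℍ[ℝ])) := by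
  have hd : α - β ≠ 0 := sub_ne_zero.mpr hne
  have ha := left_ne_zero_of_mul hab
  have hb := right_ne_zero_of_mul hab
  obtain ⟨h₀, h₁⟩ := biF_binet hab hne hα hβ m
  obtain ⟨h₂, h₃⟩ := biF_binet hab hne hα hβ (m + 1)
  rw [mul_add, mul_one] at h₂ h₃
  ext <;> simp only [biQ, h₀, h₁, h₂, h₃, QuaternionAlgebra.re_smul, QuaternionAlgebra.imI_smul,
    QuaternionAlgebra.imJ_smul, QuaternionAlgebra.imK_smul, QuaternionAlgebra.re_sub, QuaternionAlgebra.imI_sub,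
    QuaternionAlgebra.imJ_sub, QuaternionAlgebra.imK_sub, smul_eq_mul] <;> field_simp <;> ring

/-- Binet's formula for the bi-periodic Fibonacci quaternions, odd index. -/
theorem biQ_binet_odd {a b α β : ℝ} (hab : a * b ≠ 0) (hne : α ≠ β)
    (hα : α ^ 2 = a * b * α + a * b) (hβ : β ^ 2 = a * b * β + a * b) (m : ℕ) :
    biQ a b (2 * m + 1) = (1 / ((a * b) ^ m * (α - β))) •
      (α ^ (2 * m + 1) •
          (⟨1, a / (a * b) * α, 1 / (a * b) * α ^ 2, a / (a * b) ^ 2 * α ^ 3⟩ : ℍ[ℝ]) -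
        β ^ (2 * m + 1) •
          (⟨1, a / (a * b) * β, 1 / (a * b) * β ^ 2, a / (a * b) ^ 2 * β ^ 3⟩ : ℍ[ℝ])) := by
  have hd : α - β ≠ 0 := sub_ne_zero.mpr hne
  have ha := left_ne_zero_of_mul hab
  have hb := right_ne_zero_of_mul hab
  obtain ⟨-, h₁⟩ := biF_binet hab hne hα hβ m
  obtain ⟨h₂, h₃⟩ := biF_binet hab hne hα hβ (m + 1)
  obtain ⟨h₄, -⟩ := biF_binet hab hne hα hβ (m + 2)
  rw [mul_add, mul_one] at h₂ h₃
  rw [mul_add] at h₄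
  ext <;> simp only [biQ, h₁, h₂, h₃, h₄, QuaternionAlgebra.re_smul, QuaternionAlgebra.imI_smul,
    QuaternionAlgebra.imJ_smul, QuaternionAlgebra.imK_smul, QuaternionAlgebra.re_sub, QuaternionAlgebra.imI_sub,
    QuaternionAlgebra.imJ_sub, QuaternionAlgebra.imK_sub, smul_eq_mul] <;> field_simp <;> ring

/-- The noncommutative Catalan difference of two Binet-type families `c gⁱ (x pⁱ A - y qⁱ B)` and
`d gⁱ (z pⁱ C - w qⁱ D)`, for the index pairs `(0, 2)` and `(1, 1)`. -/
theorem binet_mul_sub_mul {R A : Type*} [CommRing R] [Ring A] [Algebra R A]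
    (c d g x y z w p q : R) (X Y Z W : A) :
    c • (x • X - y • Y) * (d * g ^ 2) • ((z * p ^ 2) • Z - (w * q ^ 2) • W) -
        (c * g) • ((x * p) • X - (y * q) • Y) * (d * g) • ((z * p) • Z - (w * q) • W) =
      (c * d * g ^ 2) • ((x * w * (p * q - q ^ 2)) • (X * W) +
        (y * z * (p * q - p ^ 2)) • (Y * Z)) := by
  simp only [sub_mul, mul_sub, smul_mul_assoc, mul_smul_comm]
  module

/-- The real and dual parts of a Catalan difference of bi-periodic dual Fibonacci quaternions. -/
theorem biDQ_mul_sub_sq (a b : ℝ) (k l n : ℕ) :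
    biDQ a b k * biDQ a b l - biDQ a b n ^ 2 =
      inl (biQ a b k * biQ a b l - biQ a b n * biQ a b n) +
        DualNumber.eps * inl ((biQ a b k * biQ a b (l + 1) - biQ a b n * biQ a b (n + 1)) +
          (biQ a b (k + 1) * biQ a b l - biQ a b (n + 1) * biQ a b n)) := by
  ext <;> simp [biDQ, sq] <;> abel

/-- Catalan's identity for the bi-periodic dual Fibonacci quaternions, odd index. -/
theorem biDQ_catalan_odd (a b : ℝ) (hab : 0 < a * b) (α β : ℝ)
    (hα : α = (a * b + Real.sqrt ((a * b) ^ 2 + 4 * (a * b))) / 2)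
    (hβ : β = (a * b - Real.sqrt ((a * b) ^ 2 + 4 * (a * b))) / 2)
    (αs βs αss βss : ℍ[ℝ])
    (hαs : αs = ⟨a, α, a / (a * b) * α ^ 2, 1 / (a * b) * α ^ 3⟩)
    (hβs : βs = ⟨a, β, a / (a * b) * β ^ 2, 1 / (a * b) * β ^ 3⟩)
    (hαss : αss = ⟨1, a / (a * b) * α, 1 / (a * b) * α ^ 2, a / (a * b) ^ 2 * α ^ 3⟩)
    (hβss : βss = ⟨1, a / (a * b) * β, 1 / (a * b) * β ^ 2, a / (a * b) ^ 2 * β ^ 3⟩)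
    (r n : ℕ) (hrpos : 0 < r) (hr : Even r) (hn : Odd n) (hrn : r ≤ n) :
    biDQ a b (n - r) * biDQ a b (n + r) - (biDQ a b n) ^ 2 =
      -inl ((αss * βss * (((a * b) ^ r - β ^ (2 * r) : ℝ) : ℍ[ℝ])
            + βss * αss * (((a * b) ^ r - α ^ (2 * r) : ℝ) : ℍ[ℝ]))
          / (((a * b) ^ (r - 1) * (α - β) ^ 2 : ℝ) : ℍ[ℝ]))
        - DualNumber.eps *
          inl (((αs * βss * ((α : ℝ) : ℍ[ℝ]) + αss * βs * ((β : ℝ) : ℍ[ℝ]))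
                  * (((a * b) ^ r - β ^ (2 * r) : ℝ) : ℍ[ℝ])
                + (βs * αss * ((β : ℝ) : ℍ[ℝ]) + βss * αs * ((α : ℝ) : ℍ[ℝ]))
                  * (((a * b) ^ r - α ^ (2 * r) : ℝ) : ℍ[ℝ]))
              / (((a * b) ^ r * (α - β) ^ 2 : ℝ) : ℍ[ℝ])) := by
  set E := Real.sqrt ((a * b) ^ 2 + 4 * (a * b)) with hE
  have hEpos : 0 < E := Real.sqrt_pos.mpr (by positivity)
  have hEsq : E ^ 2 = (a * b) ^ 2 + 4 * (a * b) := Real.sq_sqrt (by positivity)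
  have hab' : a * b ≠ 0 := hab.ne'
  have hne : α ≠ β := by intro h; linarith
  have hd : α - β ≠ 0 := sub_ne_zero.mpr hne
  have hα2 : α ^ 2 = a * b * α + a * b := by rw [hα]; linear_combination hEsq / 4
  have hβ2 : β ^ 2 = a * b * β + a * b := by rw [hβ]; linear_combination hEsq / 4
  have hαβ : α * β = -(a * b) := by rw [hα, hβ]; linear_combination -hEsq / 4
  clear_value E
  obtain ⟨t, rfl⟩ := Nat.exists_eq_add_of_le' hrn
  have ht : Odd t := by rwa [Nat.odd_add, iff_true_right hr] at hn
  obtain ⟨k, rfl⟩ := ht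
  obtain ⟨s, rfl⟩ := hr
  have hO (i : ℕ) : biQ a b (2 * k + 1 + i * (s + s)) =
      (1 / ((a * b) ^ k * (α - β)) * (1 / (a * b) ^ s) ^ i) •
        ((α ^ (2 * k + 1) * (α ^ (s + s)) ^ i) • αss -
          (β ^ (2 * k + 1) * (β ^ (s + s)) ^ i) • βss) := by
    rw [show 2 * k + 1 + i * (s + s) = 2 * (k + s * i) + 1 by ring,
      biQ_binet_odd hab' hne hα2 hβ2, ← hαss, ← hβss]
    congr 1
    · rw [pow_add, pow_mul, one_div_pow]; field_simp
    · congr 2 <;> ring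
  have hEv (i : ℕ) : biQ a b (2 * k + 1 + i * (s + s) + 1) =
      (1 / ((a * b) ^ (k + 1) * (α - β)) * (1 / (a * b) ^ s) ^ i) •
        ((α ^ (2 * k + 2) * (α ^ (s + s)) ^ i) • αs -
          (β ^ (2 * k + 2) * (β ^ (s + s)) ^ i) • βs) := by
    rw [show 2 * k + 1 + i * (s + s) + 1 = 2 * (k + 1 + s * i) by ring,
      biQ_binet_even hab' hne hα2 hβ2, ← hαs, ← hβs]
    congr 1
    · rw [pow_add, pow_mul, one_div_pow]; field_simp
    · congr 2 <;> ring
  have hO0 := hO 0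
  have hO1 := hO 1
  have hO2 := hO 2
  have hE0 := hEv 0
  have hE1 := hEv 1
  have hE2 := hEv 2
  simp only [zero_mul, one_mul, pow_zero, pow_one, mul_one, add_zero] at hO0 hO1 hE0 hE1
  rw [two_mul (s + s), ← add_assoc] at hO2 hE2
  have hxy : α ^ (2 * k + 1) * β ^ (2 * k + 1) = -(a * b) ^ (2 * k + 1) := by
    rw [← mul_pow, hαβ, Odd.neg_pow ⟨k, rfl⟩]
  have hpq : α ^ (s + s) * β ^ (s + s) = (a * b) ^ (s + s) := by
    rw [← mul_pow, hαβ, Even.neg_pow ⟨s, rfl⟩]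
  have hr1 : (a * b) ^ (s + s - 1) = (a * b) ^ (s + s) / (a * b) := by
    rw [eq_div_iff hab', ← pow_succ, Nat.sub_add_cancel hrpos]
  rw [Nat.add_sub_cancel, biDQ_mul_sub_sq, sub_eq_add_neg (-inl _), ← mul_neg, ← inl_neg, ← inl_neg,
    hO0, hO1, hO2, hE0, hE1, hE2, binet_mul_sub_mul, binet_mul_sub_mul, binet_mul_sub_mul, hpq]
  have hxyβ : α ^ (2 * k + 1) * β ^ (2 * k + 2) = -(a * b) ^ (2 * k + 1) * β := by
    rw [← hxy]; ring
  have hxyα : α ^ (2 * k + 2) * β ^ (2 * k + 1) = -(a * b) ^ (2 * k + 1) * α := by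
    rw [← hxy]; ring
  rw [mul_comm (β ^ (2 * k + 1)) (α ^ (2 * k + 1)), mul_comm (β ^ (2 * k + 1)) (α ^ (2 * k + 2)),
    mul_comm (β ^ (2 * k + 2)) (α ^ (2 * k + 1)), hxy, hxyα, hxyβ, hr1]
  have hc : 1 / ((a * b) ^ k * (α - β)) * (1 / ((a * b) ^ k * (α - β))) * (1 / (a * b) ^ s) ^ 2
      * (a * b) ^ (2 * k + 1) = ((a * b) ^ (s + s) / (a * b) * (α - β) ^ 2)⁻¹ := by
    generalize a * b = u at *
    field_simp
    ring
  have hc' : 1 / ((a * b) ^ k * (α - β)) * (1 / ((a * b) ^ (k + 1) * (α - β)))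
      * (1 / (a * b) ^ s) ^ 2 * (a * b) ^ (2 * k + 1) = ((a * b) ^ (s + s) * (α - β) ^ 2)⁻¹ := by
    generalize a * b = u at *
    field_simp
    ring
  simp only [div_eq_mul_inv (_ : ℍ[ℝ]), ← Quaternion.coe_inv, Quaternion.mul_coe_eq_smul, ← hc,
    ← hc']
  congr 2
  · module
  · congr 1
    module
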